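/- arXiv:1406.2754 — 2 statements merged into one kernel-verified Lean document; each statement's English description precedes it below -/
import Mathlib

section
/- Fix constants α > 5 and x₁ > 4^α, and set x_{n+1} = x_n^{1+1/α} for n ≥ 1. Let F be the distribution on [0,∞) with tail F̄(x) = 1 + (x₁^{−α} − 1)x/x₁ for 0 ≤ x < x₁, F̄(x) = x_n^{−α} + (x_n^{−α−2} − x_n^{−α−1})(x − x_n) for x_n ≤ x < 2x_n, and F̄(x) = x_n^{−α−1} for 2x_n ≤ x < x_{n+1}, n ≥ 1. Then F ∈ 𝒥: for independent X₁, X₂ with distribution F, lim_{K→∞} liminf_{x→∞} P(min(X₁,X₂) ≤ K | X₁+X₂ > x) = 1. -/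
open MeasureTheory Filter Set Topology

noncomputable section

/-- The (real-valued) tail function of a measure `F` on `ℝ`: `F̄(x) = F((x,∞))`. -/
def tail (F : Measure ℝ) (x : ℝ) : ℝ := (F (Set.Ioi x)).toReal

/-- A distribution: a Borel probability measure on `[0,∞)` with unbounded support. -/
def IsDistribution (F : Measure ℝ) : Prop :=
  IsProbabilityMeasure F ∧ F (Set.Iio 0) = 0 ∧ ∀ x : ℝ, 0 < F (Set.Ioi x)

/-- The convolution `F*2` of `F` with itself: the law of `X₁ + X₂` for independent `X₁, X₂ ∼ F`. -/
def conv2 (F : Measure ℝ) : Measure ℝ := (F.prod F).map fun p => p.1 + p.2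

/-- Heavy-tailed (class 𝒦): all exponential moments are infinite. -/
def HeavyTailed (F : Measure ℝ) : Prop :=
  ∀ a : ℝ, 0 < a → ∫⁻ y, ENNReal.ofReal (Real.exp (a * y)) ∂F = ⊤

/-- Class 𝒪𝒮 (generalized subexponential): `limsup F̄*²(x)/F̄(x) < ∞`. -/
def MemOS (F : Measure ℝ) : Prop :=
  Filter.atTop.limsup (fun x : ℝ => conv2 F (Set.Ioi x) / F (Set.Ioi x)) < ⊤

/-- Class 𝒟𝒦ᶜ (strongly heavy-tailed): `e^{λx} F̄(x) → ∞` for every `λ > 0`. -/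
def StronglyHeavyTailed (F : Measure ℝ) : Prop :=
  ∀ l : ℝ, 0 < l →
    Filter.Tendsto (fun x : ℝ => Real.exp (l * x) * tail F x) Filter.atTop Filter.atTop

/-- Class 𝒟𝒦₁: `x^δ F̄(x) → ∞` for some `δ > 0`. -/
def MemDK1 (F : Measure ℝ) : Prop :=
  ∃ δ : ℝ, 0 < δ ∧
    Filter.Tendsto (fun x : ℝ => x ^ δ * tail F x) Filter.atTop Filter.atTop

/-- Class ℒ (long-tailed): `F̄(x-t)/F̄(x) → 1` for every `t > 0`. -/
def MemL (F : Measure ℝ) : Prop :=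
  ∀ t : ℝ, 0 < t →
    Filter.Tendsto (fun x : ℝ => tail F (x - t) / tail F x) Filter.atTop (nhds 1)

/-- Class 𝒟 (dominatedly varying): `limsup F̄(x/2)/F̄(x) < ∞`. -/
def MemD (F : Measure ℝ) : Prop :=
  Filter.atTop.limsup (fun x : ℝ => F (Set.Ioi (x / 2)) / F (Set.Ioi x)) < ⊤

/-- Class 𝒪ℒ (generalized long-tailed): `limsup F̄(x-t)/F̄(x) < ∞` for every `t > 0`. -/
def MemOL (F : Measure ℝ) : Prop :=
  ∀ t : ℝ, 0 < t →
    Filter.atTop.limsup (fun x : ℝ => F (Set.Ioi (x - t)) / F (Set.Ioi x)) < ⊤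

/-- Class 𝒮 (subexponential): `F̄*²(x)/F̄(x) → 2`. -/
def MemS (F : Measure ℝ) : Prop :=
  Filter.Tendsto (fun x : ℝ => (conv2 F (Set.Ioi x)).toReal / tail F x)
    Filter.atTop (nhds 2)

/-- Class 𝒥 (principle of a single big jump, for `n = 2`):
`lim_{K→∞} liminf_{x→∞} P(min(X₁,X₂) ≤ K | X₁+X₂ > x) = 1` for independent `X₁, X₂ ∼ F`. -/
def MemJ (F : Measure ℝ) : Prop :=
  Filter.Tendsto (fun K : ℝ => Filter.atTop.liminf (fun x : ℝ =>
      ((F.prod F) {p : ℝ × ℝ | min p.1 p.2 ≤ K ∧ x < p.1 + p.2}).toReal /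
      ((F.prod F) {p : ℝ × ℝ | x < p.1 + p.2}).toReal))
    Filter.atTop (nhds 1)

/-- Weak tail equivalence: `0 < liminf F̄(x)/Ḡ(x) ≤ limsup F̄(x)/Ḡ(x) < ∞`. -/
def WeakTailEquiv (F G : Measure ℝ) : Prop :=
  0 < Filter.atTop.liminf (fun x : ℝ => F (Set.Ioi x) / G (Set.Ioi x)) ∧
  Filter.atTop.limsup (fun x : ℝ => F (Set.Ioi x) / G (Set.Ioi x)) < ⊤

open scoped ENNReal

lemma tail_le_prod_add {F : Measure ℝ} (hF : IsDistribution F) (x : ℝ) :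
    F (Ioi x) ≤ (F.prod F) {p : ℝ × ℝ | x < p.1 + p.2} := by
  obtain ⟨_, h0, -⟩ := hF
  have h1 : F (Ici 0) = 1 := by
    rw [← compl_Iio, prob_compl_eq_one_iff measurableSet_Iio, h0]
  calc F (Ioi x) = (F.prod F) (Ioi x ×ˢ Ici 0) := by rw [Measure.prod_prod, h1, mul_one]
    _ ≤ _ := by
      refine measure_mono fun p hp => ?_
      have h2 : x < p.1 := hp.1
      have h3 : 0 ≤ p.2 := hp.2
      show x < p.1 + p.2
      linarith

lemma prod_ordered_large_le {F : Measure ℝ} [IsProbabilityMeasure F] {x K : ℝ} (hK : 0 ≤ K)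
    (hx : 0 ≤ x)
    (h : ∀ y, 0 ≤ y → y ≤ x / 2 → F (Ioi (x - y)) ≤ ENNReal.ofReal (1 + y) * F (Ioi x)) :
    (F.prod F) {p : ℝ × ℝ | K < p.1 ∧ p.1 ≤ p.2 ∧ x < p.1 + p.2} ≤
      (∫⁻ y in Ioi K, ENNReal.ofReal (1 + y) ∂F) * F (Ioi x) := by
  have hm : MeasurableSet {p : ℝ × ℝ | K < p.1 ∧ p.1 ≤ p.2 ∧ x < p.1 + p.2} :=
    (measurableSet_lt measurable_const measurable_fst).inter
      ((measurableSet_le measurable_fst measurable_snd).inter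
        (measurableSet_lt measurable_const (measurable_fst.add measurable_snd)))
  rw [Measure.prod_apply hm, ← lintegral_mul_const _ (by fun_prop),
    ← lintegral_indicator measurableSet_Ioi]
  refine lintegral_mono fun y => ?_
  by_cases hy : K < y
  · rw [indicator_of_mem (show y ∈ Ioi K from hy)]
    have hle : F (Prod.mk y ⁻¹' {p : ℝ × ℝ | K < p.1 ∧ p.1 ≤ p.2 ∧ x < p.1 + p.2}) ≤
        F (Ioi (x - min y (x / 2))) := by
      refine measure_mono fun z hz => ?_
      obtain ⟨-, h2, h3⟩ : K < y ∧ y ≤ z ∧ x < y + z := hz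
      show x - min y (x / 2) < z
      rcases min_cases y (x / 2) with h | h <;> linarith [h.1]
    refine hle.trans ((h _ (le_min (hK.trans hy.le) (by linarith)) (min_le_right _ _)).trans ?_)
    gcongr
    exact min_le_left _ _
  · have : Prod.mk y ⁻¹' {p : ℝ × ℝ | K < p.1 ∧ p.1 ≤ p.2 ∧ x < p.1 + p.2} = ∅ := by
      ext z
      simp [hy]
    simp [this]

lemma prod_min_large_le {F : Measure ℝ} [IsProbabilityMeasure F] {x K : ℝ} (hK : 0 ≤ K)
    (hx : 0 ≤ x)
    (h : ∀ y, 0 ≤ y → y ≤ x / 2 → F (Ioi (x - y)) ≤ ENNReal.ofReal (1 + y) * F (Ioi x)) :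
    (F.prod F) {p : ℝ × ℝ | K < min p.1 p.2 ∧ x < p.1 + p.2} ≤
      2 * ((∫⁻ y in Ioi K, ENNReal.ofReal (1 + y) ∂F) * F (Ioi x)) := by
  set A := {p : ℝ × ℝ | K < p.1 ∧ p.1 ≤ p.2 ∧ x < p.1 + p.2} with hA
  have hm : MeasurableSet A :=
    (measurableSet_lt measurable_const measurable_fst).inter
      ((measurableSet_le measurable_fst measurable_snd).inter
        (measurableSet_lt measurable_const (measurable_fst.add measurable_snd)))
  have hswap : (F.prod F) (Prod.swap ⁻¹' A) = (F.prod F) A :=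
    Measure.measurePreserving_swap.measure_preimage hm.nullMeasurableSet
  have hsub : {p : ℝ × ℝ | K < min p.1 p.2 ∧ x < p.1 + p.2} ⊆ A ∪ Prod.swap ⁻¹' A := by
    rintro ⟨u, v⟩ ⟨h1, h2⟩
    have h3 := lt_min_iff.1 h1
    rcases le_total u v with huv | huv
    · exact Or.inl ⟨h3.1, huv, h2⟩
    · exact Or.inr ⟨h3.2, huv, by simpa [add_comm] using h2⟩
  calc _ ≤ (F.prod F) A + (F.prod F) (Prod.swap ⁻¹' A) :=
        (measure_mono hsub).trans (measure_union_le _ _)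
    _ = 2 * (F.prod F) A := by rw [hswap, two_mul]
    _ ≤ _ := by gcongr; exact prod_ordered_large_le hK hx h

lemma tendsto_measure_Ioi_atTop_zero (F : Measure ℝ) [IsFiniteMeasure F] :
    Tendsto (fun K : ℝ => F (Ioi K)) atTop (𝓝 0) := by
  have h := tendsto_measure_iInter_atTop (μ := F) (s := fun K : ℝ => Ioi K)
    (fun _ => measurableSet_Ioi.nullMeasurableSet) (fun _ _ h => Ioi_subset_Ioi h)
    ⟨0, measure_ne_top _ _⟩
  have h0 : (⋂ K : ℝ, Ioi K) = ∅ := by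
    ext z
    simpa using ⟨z, le_rfl⟩
  rwa [h0, measure_empty] at h

/-- A distribution with finite mean whose tail satisfies `F̄(x - y) ≤ (1 + y) F̄(x)` for large `x`
and `0 ≤ y ≤ x / 2` belongs to the class `𝒥`. -/
theorem memJ_of_tail_sub_le {F : Measure ℝ} (hF : IsDistribution F)
    (hmean : ∫⁻ y, ENNReal.ofReal (1 + y) ∂F ≠ ∞)
    (h : ∀ᶠ x : ℝ in atTop, ∀ y, 0 ≤ y → y ≤ x / 2 →
      F (Ioi (x - y)) ≤ ENNReal.ofReal (1 + y) * F (Ioi x)) : MemJ F := by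
  have hprob := hF.1
  set m : ℝ → ℝ≥0∞ := fun K => ∫⁻ y in Ioi K, ENNReal.ofReal (1 + y) ∂F with hm
  have hmfin : ∀ K, m K ≠ ∞ := fun K => ne_top_of_le_ne_top hmean (setLIntegral_le_lintegral _ _)
  have hm0 : Tendsto m atTop (𝓝 0) :=
    tendsto_setLIntegral_zero hmean (tendsto_measure_Ioi_atTop_zero F)
  have hlow : Tendsto (fun K => 1 - 2 * (m K).toReal) atTop (𝓝 1) := by
    have h1 := (ENNReal.tendsto_toReal ENNReal.zero_ne_top).comp hm0
    simpa using (h1.const_mul 2).const_sub 1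
  have hratio : ∀ K x : ℝ,
      ((F.prod F) {p : ℝ × ℝ | min p.1 p.2 ≤ K ∧ x < p.1 + p.2}).toReal /
        ((F.prod F) {p : ℝ × ℝ | x < p.1 + p.2}).toReal ≤ 1 := fun K x =>
    div_le_one_of_le₀ (ENNReal.toReal_mono (measure_ne_top _ _) (measure_mono fun p hp => hp.2))
      ENNReal.toReal_nonneg
  refine tendsto_of_tendsto_of_tendsto_of_le_of_le' hlow tendsto_const_nhds ?_ ?_
  · filter_upwards [eventually_ge_atTop 0] with K hK
    refine le_liminf_of_le (IsCoboundedUnder.of_frequently_le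
      (Frequently.of_forall (hratio K))) ?_
    filter_upwards [h, eventually_ge_atTop 0] with x hx hx0
    have hT : 0 < (F (Ioi x)).toReal := ENNReal.toReal_pos (hF.2.2 x).ne' (measure_ne_top _ _)
    have hTD := ENNReal.toReal_mono (measure_ne_top _ _) (tail_le_prod_add hF x)
    have hB := prod_min_large_le hK hx0 hx
    have hsub : {p : ℝ × ℝ | x < p.1 + p.2} ⊆
        {p : ℝ × ℝ | min p.1 p.2 ≤ K ∧ x < p.1 + p.2} ∪
          {p : ℝ × ℝ | K < min p.1 p.2 ∧ x < p.1 + p.2} := fun p hp =>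
      (le_or_gt (min p.1 p.2) K).imp (fun h => ⟨h, hp⟩) (fun h => ⟨h, hp⟩)
    have hD := ((measure_mono hsub).trans (measure_union_le (μ := F.prod F) _ _)).trans
      (add_le_add_right hB _)
    have hBfin : 2 * (m K * F (Ioi x)) ≠ ∞ :=
      ENNReal.mul_ne_top (by simp) (ENNReal.mul_ne_top (hmfin K) (measure_ne_top _ _))
    have hD' := ENNReal.toReal_mono (ENNReal.add_ne_top.2 ⟨measure_ne_top _ _, hBfin⟩) hD
    rw [ENNReal.toReal_add (measure_ne_top _ _) hBfin, ENNReal.toReal_mul, ENNReal.toReal_mul,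
      ENNReal.toReal_ofNat] at hD'
    rw [le_div_iff₀ (hT.trans_le hTD)]
    nlinarith [mul_le_mul_of_nonneg_left hTD (ENNReal.toReal_nonneg (a := m K))]
  · refine Eventually.of_forall fun K => ?_
    refine liminf_le_of_le ⟨0, eventually_map.2 (Eventually.of_forall fun x => by positivity)⟩ ?_
    intro b hb
    obtain ⟨x, hx⟩ := hb.exists
    exact hx.trans (hratio K x)

lemma lintegral_one_add_ne_top_of_tail_le {F : Measure ℝ} (hF : IsDistribution F) {a t₀ : ℝ}
    (ha : 1 < a) (ht₀ : 0 < t₀)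
    (h : ∀ t, t₀ ≤ t → F (Ioi t) ≤ ENNReal.ofReal ((t / 2) ^ (-a))) :
    ∫⁻ y, ENNReal.ofReal (1 + y) ∂F ≠ ∞ := by
  have hprob := hF.1
  have hnn : ∀ᵐ y ∂F, 0 ≤ y := by
    rw [ae_iff]
    simpa [Iio] using hF.2.1
  have hid : ∫⁻ y, ENNReal.ofReal y ∂F < ∞ := by
    rw [lintegral_eq_lintegral_meas_lt F hnn aemeasurable_id', ← Ioc_union_Ioi_eq_Ioi ht₀.le]
    refine (lintegral_union_le _ _ _).trans_lt (ENNReal.add_lt_top.2 ⟨?_, ?_⟩)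
    · calc ∫⁻ t in Ioc 0 t₀, F {y | t < y} ≤ ∫⁻ _ in Ioc 0 t₀, 1 :=
            lintegral_mono fun _ => prob_le_one
        _ < ∞ := by simp
    · have hint : IntegrableOn (fun t : ℝ => (t / 2) ^ (-a)) (Ioi t₀) := by
        refine IntegrableOn.congr_fun
          (((integrableOn_Ioi_rpow_of_lt (neg_lt_neg ha) ht₀).div_const (2 ^ (-a))))
          (fun t ht => ?_) measurableSet_Ioi
        exact (Real.div_rpow (ht₀.trans ht).le (by norm_num) _).symm
      refine lt_of_le_of_lt ?_ hint.lintegral_lt_top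
      exact setLIntegral_mono' measurableSet_Ioi fun t ht => h t (le_of_lt ht)
  have hle : ∫⁻ y, ENNReal.ofReal (1 + y) ∂F ≤ 1 + ∫⁻ y, ENNReal.ofReal y ∂F := by
    calc _ ≤ ∫⁻ y, (1 + ENNReal.ofReal y) ∂F := lintegral_mono fun y => by
            simpa using ENNReal.ofReal_add_le (p := 1) (q := y)
      _ = _ := by rw [lintegral_add_left measurable_const]; simp
  exact ne_top_of_le_ne_top (ENNReal.add_lt_top.2 ⟨ENNReal.one_lt_top, hid⟩).ne hle

lemma four_rpow_lt_and_four_mul_le {a : ℝ} (ha : 0 < a) {x : ℕ → ℝ} (hx1 : (4 : ℝ) ^ a < x 1)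
    (hxrec : ∀ n : ℕ, 1 ≤ n → x (n + 1) = x n ^ (1 + 1 / a)) {n : ℕ} (hn : 1 ≤ n) :
    (4 : ℝ) ^ a < x n ∧ 4 * x n ≤ x (n + 1) := by
  have h4 : (0 : ℝ) < 4 ^ a := by positivity
  have grow : ∀ m, 1 ≤ m → (4 : ℝ) ^ a < x m → 4 * x m ≤ x (m + 1) := by
    intro m hm h
    have h0 : 0 < x m := h4.trans h
    rw [hxrec m hm, Real.rpow_add h0, Real.rpow_one, mul_comm]
    gcongr
    calc (4 : ℝ) = ((4 : ℝ) ^ a) ^ (1 / a) := by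
          rw [← Real.rpow_mul (by norm_num), mul_one_div_cancel ha.ne', Real.rpow_one]
      _ ≤ _ := Real.rpow_le_rpow h4.le h.le (by positivity)
  induction n, hn using Nat.le_induction with
  | base => exact ⟨hx1, grow 1 le_rfl hx1⟩
  | succ n hn ih =>
    have h : (4 : ℝ) ^ a < x (n + 1) := by linarith [ih.1, ih.2]
    exact ⟨h, grow _ (by omega) h⟩

lemma exists_mem_Ico_of_four_mul_le {x : ℕ → ℝ} (hpos : ∀ n, 1 ≤ n → 1 < x n)
    (hgrow : ∀ n, 1 ≤ n → 4 * x n ≤ x (n + 1)) {y : ℝ} (hy : x 1 ≤ y) :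
    ∃ n, 1 ≤ n ∧ x n ≤ y ∧ y < x (n + 1) := by
  by_contra! hcon
  have hle : ∀ n : ℕ, 1 ≤ n → x n ≤ y := fun n hn => by
    induction n, hn using Nat.le_induction with
    | base => exact hy
    | succ n hn ih => exact hcon n hn ih
  have hge : ∀ n : ℕ, 1 ≤ n → (n : ℝ) ≤ x n := fun n hn => by
    induction n, hn using Nat.le_induction with
    | base => simpa using (hpos 1 le_rfl).le
    | succ n hn ih =>
      push_cast
      linarith [hpos n hn, hgrow n hn]
  obtain ⟨n, hn⟩ := exists_nat_gt (max y 1)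
  have h1 : (1 : ℝ) < n := (le_max_right _ _).trans_lt hn
  have hn1 : 1 ≤ n := by exact_mod_cast h1.le
  linarith [hle n hn1, hge n hn1, le_max_left y 1]

lemma add_mul_max_sub_le {c e u s t : ℝ} (he : 0 ≤ e) (hec : e ≤ c) (hst : s ≤ t) :
    c + e * max 0 (u - s) ≤ (1 + (t - s)) * (c + e * max 0 (u - t)) := by
  have h1 : max 0 (u - s) ≤ max 0 (u - t) + (t - s) :=
    max_le (by linarith [le_max_left 0 (u - t)]) (by linarith [le_max_right 0 (u - t)])
  have h2 := mul_le_mul_of_nonneg_left h1 he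
  have h3 := mul_le_mul_of_nonneg_right hec (sub_nonneg.2 hst)
  have h4 : 0 ≤ (t - s) * (e * max 0 (u - t)) :=
    mul_nonneg (sub_nonneg.2 hst) (mul_nonneg he (le_max_left _ _))
  nlinarith

/-- Example 3.3, membership in 𝒥: the distribution with
`F̄(y) = x_n^{-α} + (x_n^{-α-2} - x_n^{-α-1})(y - x_n)` on `[x_n, 2x_n)` and
`F̄(y) = x_n^{-α-1}` on `[2x_n, x_{n+1})`, where `α > 5`, `x₁ > 4^α`,
`x_{n+1} = x_n^{1+1/α}`, belongs to the class 𝒥. -/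
theorem example33_memJ (a : ℝ) (ha : 5 < a)
    (x : ℕ → ℝ) (hx1 : (4 : ℝ) ^ a < x 1)
    (hxrec : ∀ n : ℕ, 1 ≤ n → x (n + 1) = x n ^ (1 + 1 / a))
    (F : Measure ℝ) (hF : IsDistribution F)
    (htail0 : ∀ y : ℝ, 0 ≤ y → y < x 1 →
      F (Set.Ioi y) = ENNReal.ofReal (1 + (x 1 ^ (-a) - 1) * y / x 1))
    (htail1 : ∀ n : ℕ, 1 ≤ n → ∀ y : ℝ, x n ≤ y → y < 2 * x n →
      F (Set.Ioi y) = ENNReal.ofReal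
        (x n ^ (-a) + (x n ^ (-a - 2) - x n ^ (-a - 1)) * (y - x n)))
    (htail2 : ∀ n : ℕ, 1 ≤ n → ∀ y : ℝ, 2 * x n ≤ y → y < x (n + 1) →
      F (Set.Ioi y) = ENNReal.ofReal (x n ^ (-a - 1))) :
    MemJ F := by
  have ha0 : 0 < a := by linarith
  have hb := fun {n : ℕ} (hn : 1 ≤ n) => four_rpow_lt_and_four_mul_le ha0 hx1 hxrec hn
  have hone : ∀ n, 1 ≤ n → 1 < x n := fun n hn =>
    (Real.one_lt_rpow (by norm_num) ha0).trans (hb hn).1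
  have hpos : ∀ n, 1 ≤ n → 0 < x n := fun n hn => one_pos.trans (hone n hn)
  have hex := fun {y : ℝ} (hy : x 1 ≤ y) =>
    exists_mem_Ico_of_four_mul_le hone (fun n hn => (hb hn).2) hy
  have hc : ∀ n, 1 ≤ n → x n ^ (-a) = x n ^ (-a - 1) * x n := fun n hn => by
    rw [← Real.rpow_add_one (hpos n hn).ne', sub_add_cancel]
  have hd : ∀ n, 1 ≤ n → x n ^ (-a - 1) = x n ^ (-a - 2) * x n := fun n hn => by
    rw [← Real.rpow_add_one (hpos n hn).ne']
    ring_nf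
  have hnext : ∀ n, 1 ≤ n → x (n + 1) ^ (-a) = x n ^ (-a - 1) := fun n hn => by
    rw [hxrec n hn, ← Real.rpow_mul (hpos n hn).le]
    congr 1
    field_simp
    ring
  have hdc : ∀ n, 1 ≤ n → x n ^ (-a - 2) ≤ x n ^ (-a - 1) := fun n hn =>
    Real.rpow_le_rpow_of_exponent_le (hone n hn).le (by linarith)
  have htail : ∀ n, 1 ≤ n → ∀ t, x n ≤ t → t < x (n + 1) → F (Ioi t) = ENNReal.ofReal
      (x n ^ (-a - 1) + (x n ^ (-a - 1) - x n ^ (-a - 2)) * max 0 (2 * x n - t)) := by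
    intro n hn t h1 h2
    rcases lt_or_ge t (2 * x n) with h | h
    · rw [htail1 n hn t h1 h, max_eq_right (by linarith), hc n hn]
      congr 1
      linear_combination (-1 : ℝ) * hd n hn
    · rw [htail2 n hn t h h2, max_eq_left (by linarith), mul_zero, add_zero]
  have hblock : ∀ n, 1 ≤ n → ∀ s t, x n ≤ s → s ≤ t → t < x (n + 1) →
      F (Ioi s) ≤ ENNReal.ofReal (1 + (t - s)) * F (Ioi t) := by
    intro n hn s t h1 h2 h3
    rw [htail n hn s h1 (h2.trans_lt h3), htail n hn t (h1.trans h2) h3,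
      ← ENNReal.ofReal_mul (by linarith)]
    have hd0 : 0 ≤ x n ^ (-a - 2) := Real.rpow_nonneg (hpos n hn).le _
    exact ENNReal.ofReal_le_ofReal (add_mul_max_sub_le
      (sub_nonneg.2 (hdc n hn)) (by linarith) h2)
  refine memJ_of_tail_sub_le hF
    (lintegral_one_add_ne_top_of_tail_le hF (by linarith : 1 < a) (hpos 1 le_rfl) ?_) ?_
  · intro t ht
    obtain ⟨n, hn, h1, h2⟩ := hex ht
    have ht0 : 0 < t := (hpos n hn).trans_le h1
    rcases lt_or_ge t (2 * x n) with h | h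
    · rw [htail1 n hn t h1 h]
      refine ENNReal.ofReal_le_ofReal (le_trans ?_ (Real.rpow_le_rpow_of_nonpos
        (by positivity) (by linarith : t / 2 ≤ x n) (by linarith)))
      linarith [mul_nonneg (sub_nonneg.2 (hdc n hn)) (sub_nonneg.2 h1)]
    · rw [htail2 n hn t h h2, ← hnext n hn]
      exact ENNReal.ofReal_le_ofReal (Real.rpow_le_rpow_of_nonpos
        (by positivity) (by linarith) (by linarith))
  · filter_upwards [eventually_ge_atTop (x 2)] with t ht y hy0 hy
    have h12 : 4 * x 1 ≤ x 2 := (hb le_rfl).2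
    obtain ⟨n, hn, h1, h2⟩ := hex (y := t) (by linarith [hpos 1 le_rfl])
    rcases le_or_gt (x n) (t - y) with h | h
    · simpa using hblock n hn (t - y) t h (by linarith) h2
    obtain ⟨k, rfl⟩ : ∃ k, n = k + 1 := ⟨n - 1, by omega⟩
    have hk : 1 ≤ k := by
      by_contra hk0
      obtain rfl : k = 0 := by omega
      exact absurd h2 (not_lt.2 ht)
    have hgk := (hb hk).2
    have heq : F (Ioi (t - y)) = F (Ioi (x (k + 1))) := by
      rw [htail2 k hk _ (by linarith) h,
        htail1 (k + 1) hn _ le_rfl (by linarith [hpos _ hn]), hnext k hk]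
      simp
    rw [heq]
    refine (hblock (k + 1) hn _ t le_rfl h1 h2).trans ?_
    gcongr
    linarith
end
end

section
/- Fix constants α > 5 and x₁ > 4^α, and set x_{n+1} = x_n^{1+1/α} for n ≥ 1. Let F be the distribution on [0,∞) with tail F̄(x) = 1 + (x₁^{−α} − 1)x/x₁ for 0 ≤ x < x₁, F̄(x) = x_n^{−α} + (x_n^{−α−2} − x_n^{−α−1})(x − x_n) for x_n ≤ x < 2x_n, and F̄(x) = x_n^{−α−1} for 2x_n ≤ x < x_{n+1}, n ≥ 1. Then for each fixed t > 0, F̄(2x_n − t)/F̄(2x_n) = 1 + t − t x_n^{−1} → 1 + t as n → ∞; hence limsup_{t→∞} limsup_{x→∞} F̄(x−t)/F̄(x) = ∞, and consequently F is not weakly tail equivalent to any long-tailed distribution (in particular not to any subexponential distribution). -/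
open MeasureTheory Filter Set Topology

noncomputable section

/-- A sequence with `x₁ > 4^a` and `x_{n+1} = x_n^{1+1/a}` grows at least geometrically. -/
lemma four_rpow_le_of_rpow_rec {a : ℝ} (ha : 1 ≤ a) {x : ℕ → ℝ} (hx1 : (4 : ℝ) ^ a < x 1)
    (hxrec : ∀ n : ℕ, 1 ≤ n → x (n + 1) = x n ^ (1 + 1 / a)) {n : ℕ} (hn : 1 ≤ n) :
    (4 : ℝ) ^ a ≤ x n ∧ (4 : ℝ) ^ n ≤ x n ∧ 4 * x n ≤ x (n + 1) := by
  have h_step : ∀ n : ℕ, 1 ≤ n → (4 : ℝ) ^ a ≤ x n → 4 * x n ≤ x (n + 1) := by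
    intro n hn h
    have hpos : 0 < x n := lt_of_lt_of_le (by positivity) h
    rw [hxrec n hn, Real.rpow_add hpos, Real.rpow_one, mul_comm]
    gcongr
    calc (4 : ℝ) = ((4 : ℝ) ^ a) ^ (1 / a) := by
          rw [← Real.rpow_mul (by norm_num), mul_one_div_cancel (by linarith), Real.rpow_one]
      _ ≤ x n ^ (1 / a) := Real.rpow_le_rpow (by positivity) h (by positivity)
  have h_lower : (4 : ℝ) ^ a ≤ x n ∧ (4 : ℝ) ^ n ≤ x n := by
    induction n, hn using Nat.le_induction with
    | base =>
      refine ⟨hx1.le, le_trans ?_ hx1.le⟩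
      rw [pow_one]
      exact Real.self_le_rpow_of_one_le (by norm_num) ha
    | succ n hn ih =>
      have h4 := h_step n hn ih.1
      have hpos : 0 < (4 : ℝ) ^ a := by positivity
      refine ⟨by linarith [ih.1], ?_⟩
      rw [pow_succ]
      linarith [ih.2]
  exact ⟨h_lower.1, h_lower.2, h_step n hn h_lower.1⟩

lemma tail_eq_measureReal (G : Measure ℝ) (z : ℝ) : tail G z = G.real (Ioi z) := rfl

lemma IsDistribution.tail_pos {G : Measure ℝ} (hG : IsDistribution G) (z : ℝ) : 0 < tail G z := by
  have := hG.1
  exact ENNReal.toReal_pos (hG.2.2 z).ne' (measure_ne_top _ _)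

lemma tail_antitone (G : Measure ℝ) [IsFiniteMeasure G] : Antitone (tail G) := fun _ _ h =>
  measureReal_mono (Ioi_subset_Ioi h)

lemma tendsto_tail_atTop (G : Measure ℝ) [IsProbabilityMeasure G] :
    Tendsto (tail G) atTop (𝓝 0) := by
  have h : tail G = fun z => 1 - ProbabilityTheory.cdf G z := by
    ext z
    rw [tail_eq_measureReal, ProbabilityTheory.cdf_eq_real, ← compl_Iic,
      probReal_compl_eq_one_sub measurableSet_Iic]
  rw [h]
  simpa using (ProbabilityTheory.tendsto_cdf_atTop G).const_sub 1

/-- Splitting on the size of the first summand bounds the tail of the convolution from below. -/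
lemma IsDistribution.le_conv2_Ioi {G : Measure ℝ} (hG : IsDistribution G) {t z : ℝ}
    (ht : 0 ≤ t) (htz : t ≤ z) :
    tail G z + (1 - tail G t) * tail G z + (tail G t - tail G z) * tail G (z - t) ≤
      (conv2 G (Ioi z)).toReal := by
  have := hG.1
  have hnonneg : G.real (Ici 0) = 1 := by
    rw [← compl_Iio, probReal_compl_eq_one_sub measurableSet_Iio, measureReal_def, hG.2.1]
    simp
  have hsplit : ∀ {u v : ℝ}, u ≤ v → G.real (Ioc u v) = tail G u - tail G v := by
    intro u v huv
    rw [tail_eq_measureReal, tail_eq_measureReal, ← measureReal_sdiff (Ioi_subset_Ioi huv)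
      measurableSet_Ioi, Ioi_sdiff_Ioi]
  have hIcc : G.real (Icc 0 t) = 1 - tail G t := by
    rw [← hnonneg, tail_eq_measureReal, ← measureReal_sdiff (Ioi_subset_Ici ht) measurableSet_Ioi,
      Ici_sdiff_Ioi]
  set A : Set (ℝ × ℝ) := Ioi z ×ˢ Ici 0 with hA
  set B : Set (ℝ × ℝ) := Icc 0 t ×ˢ Ioi z with hB
  set C : Set (ℝ × ℝ) := Ioc t z ×ˢ Ioi (z - t) with hC
  have hBC : Disjoint B C := by
    rw [Set.disjoint_left]
    rintro ⟨p, q⟩ ⟨h1, -⟩ ⟨h2, -⟩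
    exact absurd h2.1 (not_lt.2 h1.2)
  have hABC : Disjoint A (B ∪ C) := by
    rw [Set.disjoint_left]
    rintro ⟨p, q⟩ ⟨h1, -⟩ (⟨h2, -⟩ | ⟨h2, -⟩)
    · exact absurd h1 (not_lt.2 (h2.2.trans htz))
    · exact absurd h1 (not_lt.2 h2.2)
  have hCm : MeasurableSet C := measurableSet_Ioc.prod measurableSet_Ioi
  have hBm : MeasurableSet B := measurableSet_Icc.prod measurableSet_Ioi
  have hconv : (conv2 G (Ioi z)).toReal = (G.prod G).real {p : ℝ × ℝ | z < p.1 + p.2} := by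
    rw [conv2, Measure.map_apply (by fun_prop) measurableSet_Ioi]
    rfl
  have hsub : A ∪ (B ∪ C) ⊆ {p : ℝ × ℝ | z < p.1 + p.2} := by
    rintro ⟨p, q⟩ (⟨h1, h2⟩ | ⟨h1, h2⟩ | ⟨h1, h2⟩) <;>
      simp only [mem_Ioi, mem_Ici, mem_Icc, mem_Ioc, mem_ofPred_eq] at * <;> linarith
  calc _ = (G.prod G).real (A ∪ (B ∪ C)) := by
        rw [measureReal_union hABC (hBm.union hCm), measureReal_union hBC hCm,
          hA, hB, hC, measureReal_prod_prod, measureReal_prod_prod, measureReal_prod_prod,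
          hnonneg, hIcc, hsplit htz, ← tail_eq_measureReal, ← tail_eq_measureReal]
        ring
    _ ≤ _ := by rw [hconv]; exact measureReal_mono hsub

/-- Subexponential distributions are long-tailed. -/
lemma MemS.memL {G : Measure ℝ} (hG : IsDistribution G) (hS : MemS G) : MemL G := by
  have := hG.1
  intro t ht
  have htail := tendsto_tail_atTop G
  have hupper : Tendsto (fun z => ((conv2 G (Ioi z)).toReal / tail G z - 1 - (1 - tail G t)) /
      (tail G t - tail G z)) atTop (𝓝 1) := by
    have h := ((hS.sub_const 1).sub_const (1 - tail G t)).div (htail.const_sub (tail G t))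
      (by simpa using (hG.tail_pos t).ne')
    rwa [sub_zero, sub_sub_eq_add_sub, show (2 - 1 + tail G t - 1 : ℝ) = tail G t by ring,
      div_self (hG.tail_pos t).ne'] at h
  refine tendsto_of_tendsto_of_tendsto_of_le_of_le' tendsto_const_nhds hupper ?_ ?_
  · filter_upwards with z
    rw [one_le_div (hG.tail_pos z)]
    exact tail_antitone G (by linarith)
  · filter_upwards [eventually_ge_atTop t, htail.eventually_lt_const (hG.tail_pos t)] with z hz hlt
    have h := hG.le_conv2_Ioi ht.le hz
    have hpos := hG.tail_pos z
    rw [le_div_iff₀ (sub_pos.2 hlt)]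
    have h' := div_le_div_of_nonneg_right h hpos.le
    rw [add_div, add_div, div_self hpos.ne', mul_div_assoc, div_self hpos.ne'] at h'
    calc _ = (tail G t - tail G z) * tail G (z - t) / tail G z := by ring
      _ ≤ _ := by linarith

lemma WeakTailEquiv.exists_bounds {F G : Measure ℝ} (hF : IsDistribution F)
    (hG : IsDistribution G) (h : WeakTailEquiv F G) :
    ∃ c C : ℝ, 0 < c ∧ 0 < C ∧
      ∀ᶠ z in atTop, c * tail G z ≤ tail F z ∧ tail F z ≤ C * tail G z := by
  have := hF.1
  have := hG.1
  obtain ⟨c, hc0, hc⟩ := exists_between h.1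
  obtain ⟨C, hC, hCtop⟩ := exists_between h.2
  refine ⟨c.toReal, C.toReal, ENNReal.toReal_pos hc0.ne' hc.ne_top,
    ENNReal.toReal_pos (ne_bot_of_gt hC) hCtop.ne, ?_⟩
  filter_upwards [eventually_lt_of_lt_liminf hc, eventually_lt_of_limsup_lt hC] with z h1 h2
  have hG0 := (hG.2.2 z).ne'
  have hGt : G (Ioi z) ≠ ⊤ := measure_ne_top _ _
  constructor
  · have := ENNReal.mul_le_of_le_div h1.le
    simpa [tail] using ENNReal.toReal_mono (measure_ne_top F (Ioi z)) this
  · have := (ENNReal.div_le_iff hG0 hGt).1 h2.le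
    simpa [tail] using ENNReal.toReal_mono (ENNReal.mul_ne_top hCtop.ne hGt) this

/-- If the tail ratios of `F` along some sequence tend to `1 + t`, which is unbounded in the shift
`t`, then no distribution weakly tail equivalent to `F` is long-tailed. -/
lemma WeakTailEquiv.not_memL {F G : Measure ℝ} (hF : IsDistribution F) (hG : IsDistribution G)
    (h : WeakTailEquiv F G) {u : ℕ → ℝ} (hu : Tendsto u atTop atTop)
    (hlim : ∀ t : ℝ, 0 < t →
      Tendsto (fun n => tail F (u n - t) / tail F (u n)) atTop (𝓝 (1 + t))) :
    ¬ MemL G := by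
  intro hL
  obtain ⟨c, C, hc, hC, hev⟩ := h.exists_bounds hF hG
  have ht : 0 < C / c := by positivity
  have hshift : Tendsto (fun z : ℝ => z - C / c) atTop atTop :=
    tendsto_atTop_add_const_right _ _ tendsto_id
  have hle : 1 + C / c ≤ C / c * 1 := by
    refine le_of_tendsto_of_tendsto (hlim _ ht) (((hL _ ht).comp hu).const_mul (C / c)) ?_
    filter_upwards [hu.eventually hev, (hshift.comp hu).eventually hev] with n h1 h2
    have hGpos := hG.tail_pos (u n)
    calc tail F (u n - C / c) / tail F (u n)
        ≤ (C * tail G (u n - C / c)) / (c * tail G (u n)) :=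
          div_le_div₀ (mul_nonneg hC.le (hG.tail_pos _).le) h2.2 (by positivity) h1.1
      _ = _ := mul_div_mul_comm _ _ _ _
  linarith

/-- Example 3.3, not weakly tail equivalent to 𝒮: for the distribution of
Example 3.3 and each fixed `t > 0`, `F̄(2x_n - t)/F̄(2x_n) = 1 + t - t x_n⁻¹ → 1 + t`;
hence `limsup_{t→∞} limsup_{x→∞} F̄(x-t)/F̄(x) = ∞` and `F` is not weakly tail equivalent
to any long-tailed distribution, in particular not to any subexponential one. -/
theorem example33_not_weakEquiv_subexp (a : ℝ) (ha : 5 < a)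
    (x : ℕ → ℝ) (hx1 : (4 : ℝ) ^ a < x 1)
    (hxrec : ∀ n : ℕ, 1 ≤ n → x (n + 1) = x n ^ (1 + 1 / a))
    (F : Measure ℝ) (hF : IsDistribution F)
    (htail0 : ∀ y : ℝ, 0 ≤ y → y < x 1 →
      F (Set.Ioi y) = ENNReal.ofReal (1 + (x 1 ^ (-a) - 1) * y / x 1))
    (htail1 : ∀ n : ℕ, 1 ≤ n → ∀ y : ℝ, x n ≤ y → y < 2 * x n →
      F (Set.Ioi y) = ENNReal.ofReal
        (x n ^ (-a) + (x n ^ (-a - 2) - x n ^ (-a - 1)) * (y - x n)))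
    (htail2 : ∀ n : ℕ, 1 ≤ n → ∀ y : ℝ, 2 * x n ≤ y → y < x (n + 1) →
      F (Set.Ioi y) = ENNReal.ofReal (x n ^ (-a - 1))) :
    (∀ t : ℝ, 0 < t →
      (∀ᶠ n : ℕ in Filter.atTop,
        tail F (2 * x n - t) / tail F (2 * x n) = 1 + t - t * (x n)⁻¹) ∧
      Filter.Tendsto (fun n : ℕ => tail F (2 * x n - t) / tail F (2 * x n))
        Filter.atTop (nhds (1 + t))) ∧
    Filter.atTop.limsup (fun t : ℝ =>
      Filter.atTop.limsup (fun z : ℝ => F (Set.Ioi (z - t)) / F (Set.Ioi z))) = ⊤ ∧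
    (¬ ∃ G : Measure ℝ, IsDistribution G ∧ MemL G ∧ WeakTailEquiv F G) ∧
    (¬ ∃ G : Measure ℝ, IsDistribution G ∧ MemS G ∧ WeakTailEquiv F G) := by
  have hxgrow {n : ℕ} (hn : 1 ≤ n) := four_rpow_le_of_rpow_rec (by linarith) hx1 hxrec hn
  have hxpos : ∀ n : ℕ, 1 ≤ n → 0 < x n := fun n hn =>
    lt_of_lt_of_le (by positivity) (hxgrow hn).1
  have hxtop : Tendsto x atTop atTop := by
    refine tendsto_atTop_mono' _ ?_ (tendsto_pow_atTop_atTop_of_one_lt (r := (4 : ℝ)) (by norm_num))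
    filter_upwards [eventually_ge_atTop 1] with n hn using (hxgrow hn).2.1
  have hutop : Tendsto (fun n => 2 * x n) atTop atTop := hxtop.const_mul_atTop (by norm_num)
  have hratio : ∀ t : ℝ, 0 < t → ∀ᶠ n : ℕ in atTop,
      tail F (2 * x n - t) / tail F (2 * x n) = 1 + t - t * (x n)⁻¹ := by
    intro t ht
    filter_upwards [eventually_ge_atTop 1, hxtop.eventually_ge_atTop t,
      hxtop.eventually_ge_atTop 1] with n hn hnt hn1
    have hpos := hxpos n hn
    set p := x n ^ (-a - 1) with hp
    have hppos : 0 < p := Real.rpow_pos_of_pos hpos _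
    have hpow : x n ^ (-a) = p * x n := by
      rw [hp, ← Real.rpow_add_one hpos.ne']
      ring_nf
    have hpow' : x n ^ (-a - 2) = p * (x n)⁻¹ := by
      rw [hp, ← div_eq_mul_inv, ← Real.rpow_sub_one hpos.ne']
      ring_nf
    have hinv : (x n)⁻¹ ≤ 1 := inv_le_one_of_one_le₀ hn1
    have hval : x n ^ (-a) + (x n ^ (-a - 2) - p) * (2 * x n - t - x n) =
        p * (1 + t - t * (x n)⁻¹) := by
      rw [hpow, hpow']
      field_simp
      ring
    have hnum : tail F (2 * x n - t) = p * (1 + t - t * (x n)⁻¹) := by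
      rw [tail, htail1 n hn _ (by linarith) (by linarith), hval, ENNReal.toReal_ofReal]
      have : 0 ≤ t * (1 - (x n)⁻¹) := mul_nonneg ht.le (by linarith)
      exact mul_nonneg hppos.le (by linarith)
    have hden : tail F (2 * x n) = p := by
      rw [tail, htail2 n hn _ le_rfl (by linarith [(hxgrow hn).2.2]), ENNReal.toReal_ofReal hppos.le]
    rw [hnum, hden, mul_div_cancel_left₀ _ hppos.ne']
  have hlim : ∀ t : ℝ, 0 < t →
      Tendsto (fun n : ℕ => tail F (2 * x n - t) / tail F (2 * x n)) atTop (𝓝 (1 + t)) := by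
    intro t ht
    have h : Tendsto (fun n => 1 + t - t * (x n)⁻¹) atTop (𝓝 (1 + t)) := by
      simpa using (hxtop.inv_tendsto_atTop.const_mul t).const_sub (1 + t)
    exact h.congr' ((hratio t ht).mono fun n hn => hn.symm)
  refine ⟨fun t ht => ⟨hratio t ht, hlim t ht⟩, ?_, ?_, ?_⟩
  · refine Tendsto.limsup_eq (tendsto_nhds_top_mono ENNReal.tendsto_ofReal_atTop ?_)
    filter_upwards [eventually_gt_atTop 0] with t ht
    refine le_limsup_of_frequently_le (hutop.frequently (Eventually.frequently ?_))
    filter_upwards [(hlim t ht).eventually_const_lt (show t < 1 + t by linarith)] with n hn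
    have := hF.1
    rw [tail, tail, ← ENNReal.toReal_div] at hn
    exact ENNReal.ofReal_le_of_le_toReal hn.le
  · rintro ⟨G, hG, hL, hFG⟩
    exact hFG.not_memL hF hG hutop hlim hL
  · rintro ⟨G, hG, hS, hFG⟩
    exact hFG.not_memL hF hG hutop hlim (hS.memL hG)
end
end
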